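/- arXiv:1806.00291 — 4 statements merged into one kernel-verified Lean document; each statement's English description precedes it below -/
import Mathlib

section
/- Let d ≥ 1, let f : ℝ^d → ℝ be L-Lipschitz (with respect to the Euclidean norm, L > 0), and let γ > 0. Then the Gaussian-smoothed version f^γ is differentiable on ℝ^d and its derivative θ ↦ Df^γ(θ) is Lipschitz with constant L/γ; that is, f^γ is (L/γ)-smooth. -/
open MeasureTheory ProbabilityTheory

/-- The standard Gaussian measure on `ℝ^d = EuclideanSpace ℝ (Fin d)`: the joint law of
`d` i.i.d. standard real Gaussian `N(0,1)` coordinates. -/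
noncomputable def stdGaussian (d : ℕ) : Measure (EuclideanSpace ℝ (Fin d)) :=
  (Measure.pi fun _ : Fin d => gaussianReal 0 1).map
    (MeasurableEquiv.toLp 2 (Fin d → ℝ))

/-- The Gaussian-smoothed version `f^γ` of `f`: `f^γ(θ) = E[f(θ + γ X)]`, `X ~ N(0, I)`. -/
noncomputable def smoothed (d : ℕ) (γ : ℝ) (f : EuclideanSpace ℝ (Fin d) → ℝ)
    (θ : EuclideanSpace ℝ (Fin d)) : ℝ :=
  ∫ x, f (θ + γ • x) ∂(stdGaussian d)



lemma pi_gauss_eq (d : ℕ) : (Measure.pi fun _ : Fin d => gaussianReal 0 1) =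
    (volume : Measure (Fin d → ℝ)).withDensity
      (fun x => ENNReal.ofReal (∏ i, gaussianPDFReal 0 1 (x i))) := by
  refine Measure.pi_eq fun s hs => ?_
  rw [withDensity_apply _ (MeasurableSet.univ_pi hs), volume_pi, Measure.restrict_pi_pi,
    ← ofReal_integral_eq_lintegral_ofReal]
  · rw [integral_fintype_prod_eq_prod (f := fun _ y => gaussianPDFReal 0 1 y),
      ENNReal.ofReal_prod_of_nonneg]
    · exact Finset.prod_congr rfl fun i _ => (gaussianReal_apply_eq_integral 0 one_ne_zero _).symm
    · exact fun i _ => integral_nonneg fun x => gaussianPDFReal_nonneg _ _ _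
  · exact Integrable.fintype_prod (f := fun _ y => gaussianPDFReal 0 1 y)
      fun i => (integrable_gaussianPDFReal 0 1).integrableOn
  · exact ae_of_all _ fun x => Finset.prod_nonneg fun i _ => gaussianPDFReal_nonneg _ _ _

lemma integral_pi_gauss (d : ℕ) (g : (Fin d → ℝ) → ℝ) :
    ∫ x, g x ∂(Measure.pi fun _ : Fin d => gaussianReal 0 1) =
      ∫ x, (∏ i, gaussianPDFReal 0 1 (x i)) * g x := by
  have hm : Measurable (fun x : Fin d → ℝ => ∏ i, gaussianPDFReal 0 1 (x i)) :=
    Finset.measurable_prod _ fun i _ =>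
      (measurable_gaussianPDFReal 0 1).comp (measurable_pi_apply i)
  rw [pi_gauss_eq, integral_withDensity_eq_integral_toReal_smul hm.ennreal_ofReal
    (ae_of_all _ fun x => ENNReal.ofReal_lt_top)]
  refine integral_congr_ae (ae_of_all _ fun x => ?_)
  simp only [smul_eq_mul]
  rw [ENNReal.toReal_ofReal (Finset.prod_nonneg fun i _ => gaussianPDFReal_nonneg _ _ _)]

lemma cameron_martin (d : ℕ) (g : (Fin d → ℝ) → ℝ) (h : Fin d → ℝ) :
    ∫ x, g (x + h) ∂(Measure.pi fun _ : Fin d => gaussianReal 0 1) =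
      ∫ x, g x * ∏ i, Real.exp (h i * x i - h i ^ 2 / 2)
        ∂(Measure.pi fun _ : Fin d => gaussianReal 0 1) := by
  rw [integral_pi_gauss, integral_pi_gauss,
    ← integral_sub_right_eq_self (fun x => (∏ i, gaussianPDFReal 0 1 (x i)) * g (x + h)) h]
  refine integral_congr_ae (ae_of_all _ fun x => ?_)
  simp only [sub_add_cancel]
  rw [mul_comm (g x), ← mul_assoc, ← Finset.prod_mul_distrib]
  congr 1
  refine Finset.prod_congr rfl fun i _ => ?_
  simp only [gaussianPDFReal, Pi.sub_apply, mul_assoc, ← Real.exp_add]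
  congr 2
  simp
  ring

lemma gauss_exp (a b : ℝ) : ∫ y, Real.exp (a * y + b) ∂(gaussianReal 0 1) =
    Real.exp (a ^ 2 / 2 + b) := by
  have := congrFun (mgf_fun_id_gaussianReal (μ := 0) (v := 1)) a
  simp only [mgf] at this
  simp only [Real.exp_add, integral_mul_const, this]
  simp

lemma gauss_exp_int (a b : ℝ) : Integrable (fun y => Real.exp (a * y + b)) (gaussianReal 0 1) := by
  simp only [Real.exp_add]
  exact (integrable_exp_mul_gaussianReal a).mul_const _

lemma W_int (d : ℕ) (h : Fin d → ℝ) :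
    Integrable (fun x : Fin d → ℝ => ∏ i, Real.exp (h i * x i - h i ^ 2 / 2))
      (Measure.pi fun _ : Fin d => gaussianReal 0 1) :=
  Integrable.fintype_prod (f := fun i y => Real.exp (h i * y - h i ^ 2 / 2))
    fun i => by simpa only [sub_eq_add_neg] using gauss_exp_int (h i) (-(h i ^ 2 / 2))

lemma W_integral (d : ℕ) (h : Fin d → ℝ) :
    ∫ x : Fin d → ℝ, ∏ i, Real.exp (h i * x i - h i ^ 2 / 2)
      ∂(Measure.pi fun _ : Fin d => gaussianReal 0 1) = 1 := by
  rw [integral_fintype_prod_eq_prod (f := fun i y => Real.exp (h i * y - h i ^ 2 / 2))]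
  simp only [sub_eq_add_neg, gauss_exp]
  simp

lemma W_sq (d : ℕ) (h x : Fin d → ℝ) : (∏ i, Real.exp (h i * x i - h i ^ 2 / 2)) ^ 2 =
    ∏ i, Real.exp ((2 * h i) * x i + -(h i ^ 2)) := by
  rw [← Finset.prod_pow]
  refine Finset.prod_congr rfl fun i _ => ?_
  rw [← Real.exp_nat_mul]
  congr 1
  push_cast
  ring

lemma W2_int (d : ℕ) (h : Fin d → ℝ) :
    Integrable (fun x : Fin d → ℝ => (∏ i, Real.exp (h i * x i - h i ^ 2 / 2)) ^ 2)
      (Measure.pi fun _ : Fin d => gaussianReal 0 1) := by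
  simp only [W_sq]
  exact Integrable.fintype_prod (f := fun i y => Real.exp ((2 * h i) * y + -(h i ^ 2)))
    fun i => gauss_exp_int _ _

lemma W2_integral (d : ℕ) (h : Fin d → ℝ) :
    ∫ x : Fin d → ℝ, (∏ i, Real.exp (h i * x i - h i ^ 2 / 2)) ^ 2
      ∂(Measure.pi fun _ : Fin d => gaussianReal 0 1) = Real.exp (∑ i, h i ^ 2) := by
  simp only [W_sq]
  rw [integral_fintype_prod_eq_prod (f := fun i y => Real.exp ((2 * h i) * y + -(h i ^ 2)))]
  simp only [gauss_exp, ← Real.exp_sum]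
  congr 1
  refine Finset.sum_congr rfl fun i _ => ?_
  ring

lemma W_sub_one (d : ℕ) (h : Fin d → ℝ) (s : ℝ) (hs : 0 < s) (hsq : s ^ 2 = ∑ i, h i ^ 2) :
    ∫ x : Fin d → ℝ, |(∏ i, Real.exp (h i * x i - h i ^ 2 / 2)) - 1|
      ∂(Measure.pi fun _ : Fin d => gaussianReal 0 1) ≤ s * ((Real.exp (s ^ 2) + 1) / 2) := by
  have i1 := W_int d h
  have i2 := W2_int d h
  have e1 := W_integral d h
  have e2 := W2_integral d h
  rw [← hsq] at e2
  set W : (Fin d → ℝ) → ℝ := fun x => ∏ i, Real.exp (h i * x i - h i ^ 2 / 2) with hW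
  set P := (Measure.pi fun _ : Fin d => gaussianReal 0 1)
  have key : ∫ x, |W x - 1| ∂P ≤ ∫ x, ((W x ^ 2 - 2 * W x + 1) * (1 / (2 * s)) + s / 2) ∂P := by
    refine integral_mono (i1.sub (integrable_const 1)).abs ?_ fun x => ?_
    · exact ((((i2.sub (i1.const_mul 2)).add (integrable_const 1)).mul_const _).add
        (integrable_const _))
    · have : (W x ^ 2 - 2 * W x + 1) * (1 / (2 * s)) + s / 2 - |W x - 1|
          = (|W x - 1| - s) ^ 2 / (2 * s) := by
        have := sq_abs (W x - 1)
        field_simp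
        linear_combination (-1) * this
      have h3 : 0 ≤ (|W x - 1| - s) ^ 2 / (2 * s) := by positivity
      change |W x - 1| ≤ (W x ^ 2 - 2 * W x + 1) * (1 / (2 * s)) + s / 2
      linarith
  refine key.trans ?_
  have i3 : Integrable (fun x => W x ^ 2 - 2 * W x) P := i2.sub (i1.const_mul 2)
  have i4 : Integrable (fun x => W x ^ 2 - 2 * W x + 1) P := i3.add (integrable_const 1)
  rw [integral_add (i4.mul_const _) (integrable_const _), integral_mul_const,
    integral_add i3 (integrable_const _), integral_sub i2 (i1.const_mul 2), integral_const_mul]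
  change ((∫ x, W x ^ 2 ∂P) - 2 * ∫ x, W x ∂P + _) * _ + _ ≤ _
  have e1' : ∫ x, W x ∂P = 1 := e1
  have e2' : ∫ x, W x ^ 2 ∂P = Real.exp (s ^ 2) := e2
  rw [e1', e2']
  simp only [integral_const, probReal_univ, one_smul]
  have h5 : Real.exp (s ^ 2) - 1 ≤ s ^ 2 * Real.exp (s ^ 2) := by
    have h6 := Real.add_one_le_exp (-(s ^ 2))
    have h7 : Real.exp (-(s ^ 2)) * Real.exp (s ^ 2) = 1 := by rw [← Real.exp_add]; simp
    nlinarith [Real.exp_pos (s ^ 2)]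
  have h8 : (Real.exp (s ^ 2) - 2 * 1 + 1) * (1 / (2 * s)) ≤
      (s ^ 2 * Real.exp (s ^ 2)) * (1 / (2 * s)) :=
    mul_le_mul_of_nonneg_right (by linarith) (by positivity)
  have h9 : (s ^ 2 * Real.exp (s ^ 2)) * (1 / (2 * s)) = s * Real.exp (s ^ 2) / 2 := by
    field_simp
  linarith

lemma shift_bound (d : ℕ) (g : (Fin d → ℝ) → ℝ) (hg : Measurable g) (M : ℝ)
    (hM : ∀ x, |g x| ≤ M) (h : Fin d → ℝ) (s : ℝ) (hs : 0 < s) (hsq : s ^ 2 = ∑ i, h i ^ 2) :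
    |∫ x, g (x + h) ∂(Measure.pi fun _ : Fin d => gaussianReal 0 1) -
      ∫ x, g x ∂(Measure.pi fun _ : Fin d => gaussianReal 0 1)| ≤
      M * (s * ((Real.exp (s ^ 2) + 1) / 2)) := by
  have i1 := W_int d h
  have hb := W_sub_one d h s hs hsq
  rw [cameron_martin]
  set P := (Measure.pi fun _ : Fin d => gaussianReal 0 1)
  have hgi : Integrable g P :=
    Integrable.of_bound hg.aestronglyMeasurable M (ae_of_all _ fun x => hM x)
  rw [← integral_sub (i1.bdd_mul hg.aestronglyMeasurable (ae_of_all _ fun x => hM x)) hgi]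
  have hM0 : 0 ≤ M := (abs_nonneg _).trans (hM 0)
  calc _ ≤ ∫ x, M * |(∏ i, Real.exp (h i * x i - h i ^ 2 / 2)) - 1| ∂P := by
        refine norm_integral_le_of_norm_le (f := fun x => g x *
          (∏ i, Real.exp (h i * x i - h i ^ 2 / 2)) - g x)
          ((i1.sub (integrable_const 1)).abs.const_mul M) (ae_of_all _ fun x => ?_)
        rw [← mul_sub_one, norm_mul]
        exact mul_le_mul_of_nonneg_right (hM x) (abs_nonneg _)
    _ ≤ _ := by
        rw [integral_const_mul]
        exact mul_le_mul_of_nonneg_left hb hM0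

lemma smoothed_eq (d : ℕ) (γ : ℝ) (f : EuclideanSpace ℝ (Fin d) → ℝ) :
    smoothed d γ f = fun θ => ∫ x, f (θ + γ • WithLp.toLp 2 x)
      ∂(Measure.pi fun _ : Fin d => gaussianReal 0 1) := by
  funext θ
  unfold smoothed
  rw [_root_.stdGaussian, integral_map_equiv]
  rfl

lemma smoothed_deriv (d : ℕ)
    (f : EuclideanSpace ℝ (Fin d) → ℝ) (L : ℝ) (hL : 0 < L)
    (hlip : ∀ x y, |f x - f y| ≤ L * ‖x - y‖) (γ : ℝ) (hγ : 0 < γ)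
    (θ : EuclideanSpace ℝ (Fin d)) :
    Integrable (fun x : Fin d → ℝ => fderiv ℝ f (θ + γ • WithLp.toLp 2 x))
      (Measure.pi fun _ : Fin d => gaussianReal 0 1) ∧
    HasFDerivAt (smoothed d γ f) (∫ x, fderiv ℝ f (θ + γ • WithLp.toLp 2 x)
      ∂(Measure.pi fun _ : Fin d => gaussianReal 0 1)) θ := by
  have hf : LipschitzWith L.toNNReal f := LipschitzWith.of_dist_le_mul fun x y => by
    rw [Real.dist_eq, dist_eq_norm, Real.coe_toNNReal _ hL.le]; exact hlip x y
  have hmt : Measurable (fun x : Fin d → ℝ => θ + γ • WithLp.toLp 2 x) := by fun_prop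
  have hfm : ∀ θ : EuclideanSpace ℝ (Fin d), Continuous
      (fun x : Fin d → ℝ => f (θ + γ • WithLp.toLp 2 x)) := fun θ =>
    hf.continuous.comp (by fun_prop)
  rw [smoothed_eq]
  refine hasFDerivAt_integral_of_dominated_loc_of_lip' (s := Set.univ) (bound := fun _ => L)
    Filter.univ_mem
    (fun θ _ => (hfm θ).aestronglyMeasurable) ?_ ?_ ?_ (integrable_const _) ?_
  · have hb : Integrable (fun x : Fin d → ℝ => |f θ| + L * γ * ∑ i, |x i|)
        (Measure.pi fun _ : Fin d => gaussianReal 0 1) := by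
      refine (integrable_const _).add (Integrable.const_mul ?_ _)
      refine integrable_finsetSum _ fun i _ => ?_
      have : Integrable (fun y : ℝ => |y|) (gaussianReal 0 1) :=
        (memLp_one_iff_integrable.1 (memLp_id_gaussianReal (μ := 0) (v := 1) 1)).abs
      exact integrable_comp_eval (X := fun _ : Fin d => ℝ) (μ := fun _ : Fin d => gaussianReal 0 1)
        (i := i) (f := fun y : ℝ => |y|) this
    refine hb.mono' (hfm θ).aestronglyMeasurable (ae_of_all _ fun x => ?_)
    have h1 := hlip (θ + γ • WithLp.toLp 2 x) θ
    rw [add_sub_cancel_left, norm_smul, Real.norm_of_nonneg hγ.le] at h1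
    have h2 : ‖WithLp.toLp 2 x‖ ≤ ∑ i, |x i| := by
      rw [EuclideanSpace.norm_eq]
      refine Real.sqrt_le_iff.2 ⟨Finset.sum_nonneg fun i _ => abs_nonneg _, ?_⟩
      simpa using Finset.sum_sq_le_sq_sum_of_nonneg (s := Finset.univ) (f := fun i => |x i|)
        (fun i _ => abs_nonneg _)
    have h3 : L * γ * ‖WithLp.toLp 2 x‖ ≤ L * γ * ∑ i, |x i| :=
      mul_le_mul_of_nonneg_left h2 (by positivity)
    have h4 := abs_sub_abs_le_abs_sub (f (θ + γ • WithLp.toLp 2 x)) (f θ)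
    rw [Real.norm_eq_abs]
    linarith
  · exact ((measurable_fderiv ℝ f).comp hmt).aestronglyMeasurable
  · refine ae_of_all _ fun x y _ => ?_
    have := hlip (y + γ • WithLp.toLp 2 x) (θ + γ • WithLp.toLp 2 x)
    rwa [add_sub_add_right_eq_sub] at this
  · have hac : (Measure.pi fun _ : Fin d => gaussianReal 0 1) ≪ volume := by
      rw [pi_gauss_eq]; exact withDensity_absolutelyContinuous _ _
    refine hac.ae_le ?_
    have hk : LipschitzWith (L.toNNReal * γ.toNNReal)
        (fun z : EuclideanSpace ℝ (Fin d) => f (θ + γ • z)) := by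
      refine hf.comp (LipschitzWith.of_dist_le_mul fun x y => ?_)
      rw [dist_add_left, dist_smul₀, Real.norm_of_nonneg hγ.le, Real.coe_toNNReal _ hγ.le]
    have h1 := hk.ae_differentiableAt (μ := volume)
    have h2 := (PiLp.volume_preserving_toLp (Fin d)).quasiMeasurePreserving.ae h1
    filter_upwards [h2] with x hx
    have hd : DifferentiableAt ℝ f (θ + γ • WithLp.toLp 2 x) := by
      have e : f = (fun z : EuclideanSpace ℝ (Fin d) => f (θ + γ • z)) ∘
          (fun y => γ⁻¹ • (y - θ)) := by
        funext y
        simp [smul_smul, hγ.ne']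
      rw [e]
      refine DifferentiableAt.comp _ ?_ (by fun_prop)
      have : γ⁻¹ • (θ + γ • WithLp.toLp 2 x - θ) = WithLp.toLp 2 x := by
        simp [smul_smul, hγ.ne']
      rw [this]
      exact hx
    exact (hasFDerivAt_comp_add_right (γ • WithLp.toLp 2 x)).2 hd.hasFDerivAt

lemma deriv_local (d : ℕ)
    (f : EuclideanSpace ℝ (Fin d) → ℝ) (L : ℝ) (hL : 0 < L)
    (hlip : ∀ x y, |f x - f y| ≤ L * ‖x - y‖) (γ : ℝ) (hγ : 0 < γ)
    (θ θ' : EuclideanSpace ℝ (Fin d)) :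
    ‖fderiv ℝ (smoothed d γ f) θ' - fderiv ℝ (smoothed d γ f) θ‖ ≤
      L * (‖θ' - θ‖ / γ * ((Real.exp ((‖θ' - θ‖ / γ) ^ 2) + 1) / 2)) := by
  rcases eq_or_ne θ' θ with rfl | hne
  · simp
  have hf : LipschitzWith L.toNNReal f := LipschitzWith.of_dist_le_mul fun x y => by
    rw [Real.dist_eq, dist_eq_norm, Real.coe_toNNReal _ hL.le]; exact hlip x y
  have hpos : 0 < ‖θ' - θ‖ := norm_pos_iff.2 (sub_ne_zero.2 hne)
  obtain ⟨i1, d1⟩ := smoothed_deriv d f L hL hlip γ hγ θ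
  obtain ⟨i2, d2⟩ := smoothed_deriv d f L hL hlip γ hγ θ'
  rw [d1.fderiv, d2.fderiv]
  refine ContinuousLinearMap.opNorm_le_bound _ (by positivity) fun v => ?_
  rw [ContinuousLinearMap.sub_apply, ContinuousLinearMap.integral_apply i1,
    ContinuousLinearMap.integral_apply i2, Real.norm_eq_abs]
  have hmt : Measurable (fun x : Fin d → ℝ => θ + γ • WithLp.toLp 2 x) := by fun_prop
  have := shift_bound d (fun x => fderiv ℝ f (θ + γ • WithLp.toLp 2 x) v)
    ((measurable_fderiv_apply_const ℝ f v).comp hmt) (L * ‖v‖)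
    (fun x => by
      refine ((fderiv ℝ f _).le_opNorm v).trans ?_
      have := norm_fderiv_le_of_lipschitz ℝ hf (x₀ := θ + γ • WithLp.toLp 2 x)
      rw [Real.coe_toNNReal _ hL.le] at this
      gcongr)
    (WithLp.ofLp (γ⁻¹ • (θ' - θ))) (‖θ' - θ‖ / γ) (by positivity) (by
      have := EuclideanSpace.real_norm_sq_eq (γ⁻¹ • (θ' - θ))
      rw [← this, norm_smul, norm_inv, Real.norm_of_nonneg hγ.le, div_eq_inv_mul])
  have e : ∀ x : Fin d → ℝ, θ + γ • WithLp.toLp 2 (x + WithLp.ofLp (γ⁻¹ • (θ' - θ))) =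
      θ' + γ • WithLp.toLp 2 x := fun x => by
    rw [WithLp.toLp_add, WithLp.toLp_ofLp, smul_add, smul_smul, mul_inv_cancel₀ hγ.ne', one_smul]
    abel
  simp only [e] at this
  refine this.trans (le_of_eq ?_)
  ring



/-- If `f : ℝ^d → ℝ` is `L`-Lipschitz (`L > 0`) and `γ > 0`, then `f^γ` is differentiable
and its derivative is `(L/γ)`-Lipschitz, i.e. `f^γ` is `(L/γ)`-smooth. -/
theorem smoothed_differentiable_lipschitz_deriv (d : ℕ) (hd : 1 ≤ d)
    (f : EuclideanSpace ℝ (Fin d) → ℝ) (L : ℝ) (hL : 0 < L)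
    (hlip : ∀ x y, |f x - f y| ≤ L * ‖x - y‖) (γ : ℝ) (hγ : 0 < γ) :
    Differentiable ℝ (smoothed d γ f) ∧
      ∀ θ θ' : EuclideanSpace ℝ (Fin d),
        ‖fderiv ℝ (smoothed d γ f) θ - fderiv ℝ (smoothed d γ f) θ'‖ ≤ L / γ * ‖θ - θ'‖ := by

  refine ⟨fun θ => (smoothed_deriv d f L hL hlip γ hγ θ).2.differentiableAt, fun θ θ' => ?_⟩
  set D := fderiv ℝ (smoothed d γ f) with hD
  set s := ‖θ - θ'‖ / γ with hs
  have key : ∀ n : ℕ, ‖D θ - D θ'‖ ≤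
      L * (s * ((Real.exp ((s / ((n : ℝ) + 1)) ^ 2) + 1) / 2)) := by
    intro n
    have hn : (0 : ℝ) < (n : ℝ) + 1 := by positivity
    set p : ℕ → EuclideanSpace ℝ (Fin d) := fun k =>
      θ' + ((k : ℝ) / ((n : ℝ) + 1)) • (θ - θ') with hp
    have h0 : p 0 = θ' := by simp [hp]
    have h1 : p (n + 1) = θ := by
      simp only [hp]
      push_cast
      rw [div_self hn.ne', one_smul]
      abel
    have hstep : ∀ k, ‖p (k + 1) - p k‖ / γ = s / ((n : ℝ) + 1) := by
      intro k
      have : p (k + 1) - p k = (1 / ((n : ℝ) + 1)) • (θ - θ') := by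
        simp only [hp]
        rw [add_sub_add_left_eq_sub, ← sub_smul]
        congr 1
        push_cast
        ring
      rw [this, norm_smul, Real.norm_of_nonneg (by positivity), hs]
      ring
    have hsum : D θ - D θ' = ∑ k ∈ Finset.range (n + 1), (D (p (k + 1)) - D (p k)) := by
      rw [Finset.sum_range_sub (fun k => D (p k)), h0, h1]
    rw [hsum]
    refine (norm_sum_le _ _).trans ?_
    calc _ ≤ ∑ k ∈ Finset.range (n + 1), L * (s / ((n : ℝ) + 1) *
          ((Real.exp ((s / ((n : ℝ) + 1)) ^ 2) + 1) / 2)) := by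
          refine Finset.sum_le_sum fun k _ => ?_
          have := deriv_local d f L hL hlip γ hγ (p k) (p (k + 1))
          rwa [hstep] at this
      _ = _ := by
          rw [Finset.sum_const, Finset.card_range, nsmul_eq_mul]
          push_cast
          field_simp
  have hlim : Filter.Tendsto
      (fun n : ℕ => L * (s * ((Real.exp ((s / ((n : ℝ) + 1)) ^ 2) + 1) / 2)))
      Filter.atTop (nhds (L * (s * ((Real.exp (0 ^ 2) + 1) / 2)))) := by
    have h1 : Filter.Tendsto (fun n : ℕ => s / ((n : ℝ) + 1)) Filter.atTop (nhds 0) := by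
      have := (tendsto_one_div_add_atTop_nhds_zero_nat (𝕜 := ℝ)).const_mul s
      simpa [div_eq_mul_inv] using this
    have hc : Continuous (fun t : ℝ => L * (s * ((Real.exp (t ^ 2) + 1) / 2))) := by fun_prop
    exact (hc.tendsto 0).comp h1
  have := ge_of_tendsto' hlim key
  refine this.trans (le_of_eq ?_)
  simp [hs]
  ring
end

section
/- Fix integers k, l ≥ 1 and d ≥ 2k+1+l, and reals α, δ > 0, γ > 0 and β ≥ γ(1 + 1/(2k)). Then the infimum over θ ∈ ℝ^d of F(θ) equals −(1/(2α)) [ (β−γ)² + γ²/(2k) + δ²/l ], and it is attained at a minimizer θ* satisfying ‖θ*‖₂² = (1/α²) [ (β−γ)² + γ²/(2k) + δ²/l ]. -/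
/-- The `i`-th coordinate (0-based) of `θ ∈ ℝ^d`, extended by `0` for out-of-range
indices. -/
def coordF (d : ℕ) (θ : EuclideanSpace ℝ (Fin d)) (i : ℕ) : ℝ :=
  if h : i < d then θ ⟨i, h⟩ else 0

/-- The worst-case function used in the lower bound under global regularity (with 1-based
math indices translated to 0-based ones):
`F(θ) = γ ∑_{i=1}^{2k} |θ_{i+1} − θ_i| − β θ₁ + δ max_{2k+2 ≤ i ≤ 2k+1+l} θ_i + (α/2)‖θ‖₂²`. -/
noncomputable def hardF (d k l : ℕ) (α β γ δ : ℝ) (θ : EuclideanSpace ℝ (Fin d)) : ℝ :=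
  γ * ∑ i ∈ Finset.range (2 * k), |coordF d θ (i + 1) - coordF d θ i|
    - β * coordF d θ 0
    + δ * sSup ((fun j => coordF d θ (2 * k + 1 + j)) '' Set.Iio l)
    + α / 2 * ‖θ‖ ^ 2

lemma norm_split (k l d : ℕ) (hd : 2 * k + 1 + l ≤ d) (θ : EuclideanSpace ℝ (Fin d)) :
    ‖θ‖ ^ 2 = (coordF d θ 0) ^ 2 + ∑ i ∈ Finset.range (2 * k), (coordF d θ (i + 1)) ^ 2
      + ∑ j ∈ Finset.range l, (coordF d θ (2 * k + 1 + j)) ^ 2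
      + ∑ j ∈ Finset.range (d - (2 * k + 1 + l)), (coordF d θ (2 * k + 1 + l + j)) ^ 2 := by
  have h1 : ‖θ‖ ^ 2 = ∑ i ∈ Finset.range d, (coordF d θ i) ^ 2 := by
    rw [EuclideanSpace.norm_sq_eq, ← Fin.sum_univ_eq_sum_range (fun i => (coordF d θ i) ^ 2) d]
    refine Finset.sum_congr rfl fun i _ => ?_
    simp [coordF]
  have h2 : Finset.range d = Finset.range (2 * k + 1 + l + (d - (2 * k + 1 + l))) := by
    congr 1; omega
  rw [h1, h2, Finset.sum_range_add, Finset.sum_range_add, Finset.sum_range_succ']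
  ring

lemma tele (x : ℕ → ℝ) (n : ℕ) :
    n * x 0 - ∑ i ∈ Finset.range n, x (i + 1) ≤
      n * ∑ i ∈ Finset.range n, |x (i + 1) - x i| := by
  have h : ∀ i ∈ Finset.range n, x 0 - x (i + 1) ≤ ∑ i ∈ Finset.range n, |x (i + 1) - x i| := by
    intro i hi
    have hs : Finset.range (i + 1) ⊆ Finset.range n := by
      intro a ha
      simp only [Finset.mem_range] at *
      omega
    calc x 0 - x (i + 1) = ∑ j ∈ Finset.range (i + 1), (x j - x (j + 1)) :=
          (Finset.sum_range_sub' x (i + 1)).symm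
      _ ≤ ∑ j ∈ Finset.range (i + 1), |x (j + 1) - x j| :=
          Finset.sum_le_sum fun j _ => by rw [abs_sub_comm]; exact le_abs_self _
      _ ≤ _ := Finset.sum_le_sum_of_subset_of_nonneg hs fun _ _ _ => abs_nonneg _
  have := Finset.sum_le_sum h
  simpa using this

lemma avg (x : ℕ → ℝ) (l : ℕ) :
    ∑ j ∈ Finset.range l, x j ≤ l * sSup (x '' Set.Iio l) := by
  have h : ∀ i ∈ Finset.range l, x i ≤ sSup (x '' Set.Iio l) := by
    intro i hi
    exact le_csSup ((Set.finite_Iio l).image x).bddAbove ⟨i, by simpa using hi, rfl⟩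
  simpa using Finset.sum_le_sum h

lemma quad (x : ℕ → ℝ) (n : ℕ) (hn : 1 ≤ n) (α a : ℝ) (hα : 0 < α) :
    -(1 / (2 * α)) * (a ^ 2 / n) ≤
      α / 2 * ∑ i ∈ Finset.range n, x i ^ 2 - a / n * ∑ i ∈ Finset.range n, x i := by
  have hn' : (0 : ℝ) < n := by exact_mod_cast hn
  have h : ∀ i ∈ Finset.range n, -(1 / (2 * α)) * (a / n) ^ 2 ≤ α / 2 * x i ^ 2 - a / n * x i := by
    intro i _
    have : α / 2 * x i ^ 2 - a / n * x i + (1 / (2 * α)) * (a / n) ^ 2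
      = 1 / (2 * α) * (α * x i - a / n) ^ 2 := by field_simp; ring
    have h2 : 0 ≤ 1 / (2 * α) * (α * x i - a / n) ^ 2 := by positivity
    linarith
  have := Finset.sum_le_sum h
  rw [Finset.sum_sub_distrib, ← Finset.mul_sum, ← Finset.mul_sum, ← Finset.mul_sum] at this
  refine le_trans (le_of_eq ?_) this
  rw [Finset.sum_const, Finset.card_range, nsmul_eq_mul]
  field_simp

lemma hardF_lower (k l d : ℕ) (hk : 1 ≤ k) (hl : 1 ≤ l) (hd : 2 * k + 1 + l ≤ d)
    (α γ δ : ℝ) (hα : 0 < α) (hγ : 0 < γ) (hδ : 0 < δ) (β : ℝ)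
    (θ : EuclideanSpace ℝ (Fin d)) :
    -(1 / (2 * α)) * ((β - γ) ^ 2 + γ ^ 2 / (2 * (k : ℝ)) + δ ^ 2 / (l : ℝ)) ≤
      hardF d k l α β γ δ θ := by
  have hk' : (0 : ℝ) < k := by exact_mod_cast hk
  have hl' : (0 : ℝ) < l := by exact_mod_cast hl
  unfold hardF
  rw [norm_split k l d hd θ]
  have t := tele (coordF d θ) (2 * k)
  have m := avg (fun j => coordF d θ (2 * k + 1 + j)) l
  have q0 := quad (fun _ => coordF d θ 0) 1 le_rfl α (β - γ) hα
  have q1 := quad (fun i => coordF d θ (i + 1)) (2 * k) (by omega) α γ hα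
  have q2 := quad (fun j => coordF d θ (2 * k + 1 + j)) l hl α (-δ) hα
  have r : 0 ≤ α / 2 * ∑ j ∈ Finset.range (d - (2 * k + 1 + l)),
    (coordF d θ (2 * k + 1 + l + j)) ^ 2 := by positivity
  simp only [Finset.sum_range_one, Nat.cast_one, div_one] at q0
  push_cast at t q1
  beta_reduce at m q1 q2
  generalize (∑ i ∈ Finset.range (2 * k), |coordF d θ (i + 1) - coordF d θ i|) = T at *
  generalize sSup ((fun j => coordF d θ (2 * k + 1 + j)) '' Set.Iio l) = M at *
  generalize (∑ i ∈ Finset.range (2 * k), coordF d θ (i + 1)) = S1 at *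
  generalize (∑ i ∈ Finset.range l, coordF d θ (2 * k + 1 + i)) = S2 at *
  have t' : γ * coordF d θ 0 - γ / (2 * k) * S1 ≤ γ * T := by
    have := mul_le_mul_of_nonneg_left t (by positivity : 0 ≤ γ / (2 * k))
    have e1 : γ / (2 * k) * (2 * k * coordF d θ 0 - S1) = γ * coordF d θ 0 - γ / (2 * k) * S1 := by
      field_simp
    have e2 : γ / (2 * k) * (2 * k * T) = γ * T := by field_simp
    linarith
  have m' : δ / l * S2 ≤ δ * M := by
    have := mul_le_mul_of_nonneg_left m (by positivity : 0 ≤ δ / l)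
    have e2 : δ / l * (l * M) = δ * M := by field_simp
    linarith
  rw [neg_sq, neg_div] at q2
  linarith

/-- The infimum of the worst-case function `F` equals
`−(1/(2α))[(β−γ)² + γ²/(2k) + δ²/l]`, attained at a minimizer `θ*` with
`‖θ*‖₂² = (1/α²)[(β−γ)² + γ²/(2k) + δ²/l]`. -/
theorem hardF_inf (k l d : ℕ) (hk : 1 ≤ k) (hl : 1 ≤ l) (hd : 2 * k + 1 + l ≤ d)
    (α γ δ : ℝ) (hα : 0 < α) (hγ : 0 < γ) (hδ : 0 < δ)
    (β : ℝ) (hβ : γ * (1 + 1 / (2 * (k : ℝ))) ≤ β) :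
    ∃ θs : EuclideanSpace ℝ (Fin d),
      (∀ θ : EuclideanSpace ℝ (Fin d), hardF d k l α β γ δ θs ≤ hardF d k l α β γ δ θ) ∧
      hardF d k l α β γ δ θs =
        -(1 / (2 * α)) * ((β - γ) ^ 2 + γ ^ 2 / (2 * (k : ℝ)) + δ ^ 2 / (l : ℝ)) ∧
      ‖θs‖ ^ 2 = (1 / α ^ 2) * ((β - γ) ^ 2 + γ ^ 2 / (2 * (k : ℝ)) + δ ^ 2 / (l : ℝ)) := by
  have hk' : (0 : ℝ) < k := by exact_mod_cast hk
  have hl' : (0 : ℝ) < l := by exact_mod_cast hl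
  let v : ℕ → ℝ := fun i => if i = 0 then (β - γ) / α else
    if i < 2 * k + 1 then γ / (2 * k * α) else if i < 2 * k + 1 + l then -δ / (l * α) else 0
  let θs : EuclideanSpace ℝ (Fin d) := WithLp.toLp 2 (fun i => v i)
  have c : ∀ i, coordF d θs i = v i := by
    intro i
    by_cases h : i < d
    · simp [coordF, θs, h]
    · have : v i = 0 := by
        simp only [v]
        rw [if_neg (by omega), if_neg (by omega), if_neg (by omega)]
      simp [coordF, h, this]
  have c0 : coordF d θs 0 = (β - γ) / α := by rw [c]; simp [v]
  have c1 : ∀ i < 2 * k, coordF d θs (i + 1) = γ / (2 * k * α) := by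
    intro i hi; rw [c]; simp only [v]; rw [if_neg (by omega), if_pos (by omega)]
  have c2 : ∀ j < l, coordF d θs (2 * k + 1 + j) = -δ / (l * α) := by
    intro i hi; rw [c]; simp only [v]
    rw [if_neg (by omega), if_neg (by omega), if_pos (by omega)]
  have c3 : ∀ j, coordF d θs (2 * k + 1 + l + j) = 0 := by
    intro i; rw [c]; simp only [v]
    rw [if_neg (by omega), if_neg (by omega), if_neg (by omega)]
  have hN : ‖θs‖ ^ 2 =
      (1 / α ^ 2) * ((β - γ) ^ 2 + γ ^ 2 / (2 * (k : ℝ)) + δ ^ 2 / (l : ℝ)) := by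
    rw [norm_split k l d hd θs, c0,
      Finset.sum_congr rfl (fun i hi => by rw [c1 i (Finset.mem_range.1 hi)]),
      Finset.sum_congr (s₁ := Finset.range l) rfl
        (fun i hi => by rw [c2 i (Finset.mem_range.1 hi)]),
      Finset.sum_congr (s₁ := Finset.range (d - (2 * k + 1 + l))) rfl
        (fun i _ => by rw [c3 i])]
    simp only [Finset.sum_const, Finset.card_range, nsmul_eq_mul]
    push_cast
    field_simp
    ring
  have hT : ∑ i ∈ Finset.range (2 * k), |coordF d θs (i + 1) - coordF d θs i|
      = (β - γ) / α - γ / (2 * k * α) := by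
    rw [Finset.sum_eq_single_of_mem 0 (by simp; omega)]
    · rw [c1 0 (by omega), c0, abs_sub_comm, abs_of_nonneg]
      have e : (β - γ) / α - γ / (2 * k * α) = (β - γ * (1 + 1 / (2 * (k : ℝ)))) / α := by
        field_simp
        ring
      rw [e]
      exact div_nonneg (by linarith) hα.le
    · intro i hi h0
      obtain ⟨j, rfl⟩ := Nat.exists_eq_succ_of_ne_zero h0
      have hi := Finset.mem_range.1 hi
      rw [c1 _ hi, Nat.succ_eq_add_one, c1 j (by omega)]
      simp
  have hM : sSup ((fun j => coordF d θs (2 * k + 1 + j)) '' Set.Iio l) = -δ / (l * α) := by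
    have : (fun j => coordF d θs (2 * k + 1 + j)) '' Set.Iio l = {-δ / (l * α)} := by
      ext y
      simp only [Set.mem_image, Set.mem_Iio, Set.mem_singleton_iff]
      constructor
      · rintro ⟨j, hj, rfl⟩
        exact c2 j hj
      · rintro rfl
        exact ⟨0, by omega, c2 0 (by omega)⟩
    rw [this, csSup_singleton]
  have hF : hardF d k l α β γ δ θs =
      -(1 / (2 * α)) * ((β - γ) ^ 2 + γ ^ 2 / (2 * (k : ℝ)) + δ ^ 2 / (l : ℝ)) := by
    unfold hardF
    rw [hT, hM, hN, c0]
    field_simp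
    ring
  refine ⟨θs, fun θ => ?_, hF, hN⟩
  rw [hF]
  exact hardF_lower k l d hk hl hd α γ δ hα hγ hδ β θ
end

section
/- Let L > 0, D > 0, t > 0 be reals and n ≥ 1 an integer. Define k = ⌊t/(2D)⌋ + 1, l = ⌊t⌋ + 1, δ = L n / 9, γ = L n / (9√k), β = γ(1 + 1/√(2k)), and let α, R > 0 satisfy α² R² = (β−γ)² + γ²/(2k) + δ²/l. Then: (i) (1/n) [ β + 2√(2k+1)·γ + δ + αR ] ≤ L, and (ii) (1/(2αn)) [ γ²/(2k) + δ²/l ] ≥ (R L / 36) · √( 1/(1 + t/(2D))² + 1/(1 + t) ). -/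
/-- The parameter-choice computation in the proof of the lower complexity bound under
global regularity: with `k = ⌊t/(2D)⌋ + 1`, `l = ⌊t⌋ + 1`, `δ = Ln/9`, `γ = Ln/(9√k)`,
`β = γ(1 + 1/√(2k))` and `α, R > 0` with `α²R² = (β−γ)² + γ²/(2k) + δ²/l`, one has
(i) `(1/n)[β + 2√(2k+1)γ + δ + αR] ≤ L` and
(ii) `(1/(2αn))[γ²/(2k) + δ²/l] ≥ (RL/36)√(1/(1+t/(2D))² + 1/(1+t))`. -/
theorem lower_bound_parameter_choice (L D t : ℝ) (hL : 0 < L) (hD : 0 < D) (ht : 0 < t)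
    (n : ℕ) (hn : 1 ≤ n)
    (k l : ℕ) (hk : k = ⌊t / (2 * D)⌋₊ + 1) (hl : l = ⌊t⌋₊ + 1)
    (δ γ β : ℝ) (hδ : δ = L * n / 9) (hγ : γ = L * n / (9 * Real.sqrt k))
    (hβ : β = γ * (1 + 1 / Real.sqrt (2 * (k : ℝ))))
    (α R : ℝ) (hα : 0 < α) (hR : 0 < R)
    (hαR : α ^ 2 * R ^ 2 = (β - γ) ^ 2 + γ ^ 2 / (2 * (k : ℝ)) + δ ^ 2 / (l : ℝ)) :
    (1 / n : ℝ) * (β + 2 * Real.sqrt (2 * (k : ℝ) + 1) * γ + δ + α * R) ≤ L ∧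
      R * L / 36 * Real.sqrt (1 / (1 + t / (2 * D)) ^ 2 + 1 / (1 + t)) ≤
        1 / (2 * α * n) * (γ ^ 2 / (2 * (k : ℝ)) + δ ^ 2 / (l : ℝ)) := by
  have hk1 : (1:ℝ) ≤ k := by rw [hk]; push_cast; linarith [Nat.cast_nonneg (α := ℝ) ⌊t / (2 * D)⌋₊]
  have hl1 : (1:ℝ) ≤ l := by rw [hl]; push_cast; linarith [Nat.cast_nonneg (α := ℝ) ⌊t⌋₊]
  have hku : (k:ℝ) ≤ 1 + t / (2 * D) := by
    rw [hk]; push_cast; linarith [Nat.floor_le (show 0 ≤ t / (2 * D) by positivity)]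
  have hlu : (l:ℝ) ≤ 1 + t := by
    rw [hl]; push_cast; linarith [Nat.floor_le ht.le]
  clear hk hl
  have hn0 : (0:ℝ) < n := by exact_mod_cast hn
  generalize (k:ℝ) = K at *
  generalize (l:ℝ) = M at *
  generalize (n:ℝ) = N at *
  have hK0 : 0 < K := by linarith
  have hM0 : 0 < M := by linarith
  have hc : 0 < δ := by rw [hδ]; positivity
  have hLN : L * N = 9 * δ := by rw [hδ]; ring
  have hL' : L = 9 * δ / N := by field_simp; linarith
  have hr0 : 0 < √K := by positivity
  have hr1 : 1 ≤ √K := Real.one_le_sqrt.mpr hk1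
  have hγ' : γ = δ / √K := by rw [hγ, hLN]; field_simp
  have hγ0 : 0 < γ := by rw [hγ']; positivity
  have hγle : γ ≤ δ := by rw [hγ']; exact div_le_self hc.le hr1
  have hγ2 : γ ^ 2 = δ ^ 2 / K := by rw [hγ', div_pow, Real.sq_sqrt hK0.le]
  have hbg : (β - γ) ^ 2 = γ ^ 2 / (2 * K) := by
    have : β - γ = γ / √(2 * K) := by rw [hβ]; ring
    rw [this, div_pow, Real.sq_sqrt (by positivity)]
  have hS : (α * R) ^ 2 = δ ^ 2 * (1 / K ^ 2 + 1 / M) := by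
    rw [mul_pow, hαR, hbg, hγ2]; field_simp; ring
  have hKi : 1 / K ^ 2 ≤ 1 := by rw [div_le_one (by positivity)]; nlinarith
  have hMi : 1 / M ≤ 1 := by rw [div_le_one (by positivity)]; exact hl1
  have hαR0 : 0 < α * R := by positivity
  constructor
  · have h1 : β ≤ 2 * γ := by
      have h2 : 1 / √(2 * K) ≤ 1 := by
        rw [div_le_one (by positivity)]; exact Real.one_le_sqrt.mpr (by linarith)
      rw [hβ]; nlinarith
    have h2 : √(2 * K + 1) * γ ≤ 7 / 4 * δ := by
      apply abs_le_of_sq_le_sq' _ (by positivity) |>.2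
      rw [mul_pow, Real.sq_sqrt (by positivity), hγ2, mul_div_assoc', div_le_iff₀ hK0]
      nlinarith [mul_pos hc hc, mul_le_mul_of_nonneg_left hk1 (mul_pos hc hc).le]
    have h3 : α * R ≤ 3 / 2 * δ := by
      apply abs_le_of_sq_le_sq' _ (by positivity) |>.2
      rw [hS]; nlinarith [mul_pos hc hc]
    rw [one_div, inv_mul_le_iff₀ hn0, mul_comm N L, hLN, mul_assoc 2]
    linarith
  · have hsq : δ * √(1 / (1 + t / (2 * D)) ^ 2 + 1 / (1 + t)) ≤ α * R := by
      apply abs_le_of_sq_le_sq' _ hαR0.le |>.2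
      rw [mul_pow, Real.sq_sqrt (by positivity), hS]
      gcongr
    have hX : (α * R) ^ 2 / 2 ≤ γ ^ 2 / (2 * K) + δ ^ 2 / M := by
      have : 0 < δ ^ 2 / M := by positivity
      rw [mul_pow, hαR, hbg]; linarith
    calc R * L / 36 * √(1 / (1 + t / (2 * D)) ^ 2 + 1 / (1 + t)) 
        = R / (4 * N) * (δ * √(1 / (1 + t / (2 * D)) ^ 2 + 1 / (1 + t))) := by
          rw [hL']; ring
      _ ≤ R / (4 * N) * (α * R) := by gcongr
      _ = 1 / (2 * α * N) * ((α * R) ^ 2 / 2) := by field_simp; ring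
      _ ≤ _ := by gcongr
end

section
/- Let W be a real symmetric n×n matrix with W·𝟙 = 0, and λ > 0 such that vᵀ W v ≥ λ ‖v‖₂² for every v ∈ ℝ^n with ∑_i v_i = 0. Let K ⊆ ℝ^d be a convex set, let f₁, …, f_n : ℝ^d → ℝ with each f_i being L_i-Lipschitz (L_i ≥ 0), and set c = (1/√n)·√((1/n) ∑_{i=1}^n L_i² / λ). Suppose θ₁, …, θ_n ∈ K and ε ≥ 0 are such that, for all θ'₁, …, θ'_n ∈ K, (1/n) ∑_i f_i(θ_i) + c·√(tr(Θ W Θᵀ)) ≤ (1/n) ∑_i f_i(θ'_i) + c·√(tr(Θ' W Θ'ᵀ)) + ε, where Θ (resp. Θ') is the d×n matrix with columns θ_i (resp. θ'_i). Then the average θ̄ = (1/n) ∑_i θ_i lies in K and satisfies (1/n) ∑_i f_i(θ̄) ≤ inf_{θ ∈ K} (1/n) ∑_i f_i(θ) + ε. -/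
open Matrix

/-- The matrix whose columns are the vectors `θ 0, …, θ (n−1) ∈ ℝ^d`. -/
def colMatrix {n d : ℕ} (θ : Fin n → EuclideanSpace ℝ (Fin d)) : Matrix (Fin d) (Fin n) ℝ :=
  Matrix.of fun r i => θ i r

theorem trace_colMatrix {n d : ℕ} (W : Matrix (Fin n) (Fin n) ℝ)
    (θ : Fin n → EuclideanSpace ℝ (Fin d)) :
    (colMatrix θ * W * (colMatrix θ)ᵀ).trace
      = ∑ r, (fun i => θ i r) ⬝ᵥ (W *ᵥ (fun i => θ i r)) := by
  unfold Matrix.trace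
  refine Finset.sum_congr rfl fun r _ => ?_
  rw [Matrix.mul_assoc]
  rfl

theorem quad_shift {n : ℕ} (W : Matrix (Fin n) (Fin n) ℝ) (hWsymm : W.IsSymm)
    (hW1 : W *ᵥ (fun _ => (1 : ℝ)) = 0) (v : Fin n → ℝ) (m : ℝ) :
    (fun i => v i - m) ⬝ᵥ (W *ᵥ (fun i => v i - m)) = v ⬝ᵥ (W *ᵥ v) := by
  have e : (fun i => v i - m) = v - m • (fun _ => (1 : ℝ)) := by
    ext i; simp
  have h1 : (fun _ => (1 : ℝ)) ⬝ᵥ (W *ᵥ v) = 0 := by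
    rw [Matrix.dotProduct_mulVec, ← Matrix.mulVec_transpose, hWsymm.eq, hW1, zero_dotProduct]
  rw [e, Matrix.mulVec_sub, Matrix.mulVec_smul, hW1, smul_zero, sub_zero, sub_dotProduct,
    smul_dotProduct, h1, smul_zero, sub_zero]

/-- Key reduction in the MSPD analysis: an `ε`-minimizer `(θ₁, …, θ_n) ∈ Kⁿ` of the
penalized objective `(1/n)∑ᵢ fᵢ(θᵢ) + c‖ΘA‖_F` (where `‖ΘA‖_F² = tr(Θ W Θᵀ)` and
`c = (1/√n)√((1/n)∑ Lᵢ²/λ)`) yields an average `θ̄ ∈ K` that is an `ε`-minimizer of the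
original average objective over `K`. -/
theorem mspd_penalized_reduction (n d : ℕ) (hn : 0 < n)
    (W : Matrix (Fin n) (Fin n) ℝ) (hWsymm : W.IsSymm)
    (hW1 : W *ᵥ (fun _ => (1 : ℝ)) = 0)
    (lam : ℝ) (hlam : 0 < lam)
    (hspec : ∀ v : Fin n → ℝ, ∑ i, v i = 0 → lam * ∑ i, v i ^ 2 ≤ v ⬝ᵥ (W *ᵥ v))
    (K : Set (EuclideanSpace ℝ (Fin d))) (hK : Convex ℝ K)
    (f : Fin n → EuclideanSpace ℝ (Fin d) → ℝ) (L : Fin n → ℝ) (hL : ∀ i, 0 ≤ L i)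
    (hlip : ∀ i, ∀ x y : EuclideanSpace ℝ (Fin d), |f i x - f i y| ≤ L i * ‖x - y‖)
    (c : ℝ) (hc : c = (1 / Real.sqrt n) * Real.sqrt (((1 / n : ℝ) * ∑ i, L i ^ 2) / lam))
    (θ : Fin n → EuclideanSpace ℝ (Fin d)) (hθK : ∀ i, θ i ∈ K)
    (ε : ℝ) (hε : 0 ≤ ε)
    (happrox : ∀ θ' : Fin n → EuclideanSpace ℝ (Fin d), (∀ i, θ' i ∈ K) →
      (1 / n : ℝ) * ∑ i, f i (θ i) +
          c * Real.sqrt ((colMatrix θ * W * (colMatrix θ)ᵀ).trace) ≤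
        (1 / n : ℝ) * ∑ i, f i (θ' i) +
          c * Real.sqrt ((colMatrix θ' * W * (colMatrix θ')ᵀ).trace) + ε) :
    ((1 / n : ℝ) • ∑ i, θ i) ∈ K ∧
      ∀ θ'' ∈ K,
        (1 / n : ℝ) * ∑ i, f i ((1 / n : ℝ) • ∑ j, θ j) ≤
          (1 / n : ℝ) * ∑ i, f i θ'' + ε := by
  have hn0 : (0 : ℝ) < n := by exact_mod_cast hn
  refine ⟨?_, ?_⟩
  · rw [Finset.smul_sum]
    refine hK.sum_mem (fun i _ => by positivity) ?_ (fun i _ => hθK i)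
    simp [hn0.ne']
  intro t ht
  have h0 := happrox (fun _ => t) (fun _ => ht)
  have ht0 : (colMatrix (fun _ : Fin n => t) * W * (colMatrix (fun _ : Fin n => t))ᵀ).trace = 0 := by
    rw [trace_colMatrix]
    refine Finset.sum_eq_zero fun r _ => ?_
    rw [← quad_shift W hWsymm hW1 _ (t r)]
    simp [dotProduct]
  rw [ht0, Real.sqrt_zero, mul_zero, add_zero] at h0
  refine le_trans ?_ h0
  set b := (1 / n : ℝ) • ∑ j, θ j with hb
  set T := (colMatrix θ * W * (colMatrix θ)ᵀ).trace with hT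
  have hTl : lam * ∑ i, ‖b - θ i‖ ^ 2 ≤ T := by
    have : ∑ i, ‖b - θ i‖ ^ 2 = ∑ r, ∑ i, (θ i r - b r) ^ 2 := by
      rw [Finset.sum_comm]
      refine Finset.sum_congr rfl fun i _ => ?_
      rw [norm_sub_rev, EuclideanSpace.real_norm_sq_eq]
      simp
    rw [this, hT, trace_colMatrix, Finset.mul_sum]
    refine Finset.sum_le_sum fun r _ => ?_
    rw [← quad_shift W hWsymm hW1 _ (b r)]
    refine hspec _ ?_
    have hbr : b r = (1 / n : ℝ) * ∑ j, θ j r := by simp [hb]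
    rw [Finset.sum_sub_distrib, hbr]
    simp
    field_simp
    simp
  have hc' : c = (1 / n : ℝ) * (√(∑ i, L i ^ 2) / √lam) := by
    rw [hc, mul_div_assoc, Real.sqrt_mul (by positivity),
      Real.sqrt_div (by positivity), Real.sqrt_div (by positivity), Real.sqrt_one, ← mul_assoc]
    congr 1
    rw [div_mul_div_comm, Real.mul_self_sqrt hn0.le, one_mul]
  have hCS : ∑ i, L i * ‖b - θ i‖ ≤ √(∑ i, L i ^ 2) / √lam * √T := by
    refine (Real.sum_mul_le_sqrt_mul_sqrt _ _ _).trans ?_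
    rw [div_mul_eq_mul_div, mul_div_assoc, ← Real.sqrt_div' _ hlam.le]
    gcongr
    rw [le_div_iff₀ hlam, mul_comm]
    exact hTl
  have hsum : ∑ i, f i b ≤ ∑ i, f i (θ i) + ∑ i, L i * ‖b - θ i‖ := by
    rw [← Finset.sum_add_distrib]
    refine Finset.sum_le_sum fun i _ => ?_
    have := (abs_le.mp (hlip i b (θ i))).2
    linarith
  rw [hc', mul_assoc, ← mul_add]
  gcongr
  linarith
end
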